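/- Let γ > 1, α ∈ (0, ᾱ(γ)), ε ∈ (0,1), with K^{(α),γ}(t,τ) = (1+τ) sup_{k,l ∈ ℤ∖{0}} e^{−α|l|} e^{−α(t−τ)|k−l|/t} e^{−α|k(t−τ)+lτ|}/(1+|k−l|^γ). Then sup_{τ ≥ 0} e^{ετ} ∫_τ^∞ e^{−εt} K^{(α),γ}(t,τ) dt ≤ C(γ) (1/(α²ε) + 1/(α ε^γ)) for some constant C(γ) depending only on γ. -/

import Mathlib

open Real

/-- The plasma-echo interaction kernel `K^{(α),γ}(t,τ)`. -/
noncomputable def echoKernel (α γ t τ : ℝ) : ℝ :=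
  (1 + τ) * ⨆ k : {k : ℤ // k ≠ 0}, ⨆ l : {l : ℤ // l ≠ 0},
    Real.exp (-α * |(l.1 : ℝ)|) * Real.exp (-α * (t - τ) * |((k.1 : ℝ) - (l.1 : ℝ))| / t) *
      Real.exp (-α * |(k.1 : ℝ) * (t - τ) + (l.1 : ℝ) * τ|) /
      (1 + |((k.1 : ℝ) - (l.1 : ℝ))| ^ γ)

open MeasureTheory Set in
theorem lintegral_Ioi_ofReal_exp_neg_mul_sub {a : ℝ} (ha : 0 < a) (p : ℝ) :
    ∫⁻ t in Ioi p, ENNReal.ofReal (exp (-a * (t - p))) = ENNReal.ofReal (1 / a) := by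
  have hfun : (fun t : ℝ => exp (-a * (t - p))) = fun t => exp (a * p) * exp (-a * t) := by
    funext t
    rw [← Real.exp_add]
    ring_nf
  rw [← ofReal_integral_eq_lintegral_ofReal]
  · rw [hfun, integral_const_mul, integral_exp_mul_Ioi (by linarith), neg_div_neg_eq,
      ← mul_div_assoc, ← Real.exp_add]
    simp
  · rw [hfun]
    exact (integrableOn_exp_mul_Ioi (by linarith) p).const_mul _
  · exact ae_of_all _ fun t => (exp_pos _).le

open MeasureTheory Set in
theorem lintegral_Iic_ofReal_exp_mul_sub {a : ℝ} (ha : 0 < a) (p : ℝ) :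
    ∫⁻ t in Iic p, ENNReal.ofReal (exp (a * (t - p))) = ENNReal.ofReal (1 / a) := by
  have hfun : (fun t : ℝ => exp (a * (t - p))) = fun t => exp (-a * p) * exp (a * t) := by
    funext t
    rw [← Real.exp_add]
    ring_nf
  rw [← ofReal_integral_eq_lintegral_ofReal]
  · rw [hfun, integral_const_mul, integral_exp_mul_Iic ha, ← mul_div_assoc, ← Real.exp_add]
    simp
  · rw [hfun]
    exact (integrableOn_exp_mul_Iic ha p).const_mul _
  · exact ae_of_all _ fun t => (exp_pos _).le

open MeasureTheory Set in
theorem lintegral_ofReal_exp_neg_mul_abs_sub_le {a : ℝ} (ha : 0 < a) (p : ℝ) :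
    ∫⁻ t, ENNReal.ofReal (exp (-a * |t - p|)) ≤ ENNReal.ofReal (2 / a) := by
  rw [← lintegral_add_compl _ (measurableSet_Ioi (a := p)), compl_Ioi]
  have h1 : ∫⁻ t in Ioi p, ENNReal.ofReal (exp (-a * |t - p|)) = ENNReal.ofReal (1 / a) := by
    rw [← lintegral_Ioi_ofReal_exp_neg_mul_sub ha p]
    refine setLIntegral_congr_fun measurableSet_Ioi fun t ht => ?_
    simp only [abs_of_pos (sub_pos.2 (mem_Ioi.1 ht))]
  have h2 : ∫⁻ t in Iic p, ENNReal.ofReal (exp (-a * |t - p|)) = ENNReal.ofReal (1 / a) := by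
    rw [← lintegral_Iic_ofReal_exp_mul_sub ha p]
    refine setLIntegral_congr_fun measurableSet_Iic fun t ht => ?_
    simp only [abs_of_nonpos (sub_nonpos.2 (mem_Iic.1 ht)), neg_mul_neg]
  rw [h1, h2, ← ENNReal.ofReal_add (by positivity) (by positivity)]
  exact ENNReal.ofReal_le_ofReal (by ring_nf; rfl)

theorem one_add_mul_exp_neg_mul_le {c x : ℝ} (hc : 0 < c) (hx : 0 ≤ x) :
    (1 + x) * exp (-(c * x)) ≤ 1 + 1 / c := by
  have h1 : c * x * exp (-(c * x)) ≤ 1 := by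
    rw [exp_neg, ← div_eq_mul_inv, div_le_one (exp_pos _)]
    linarith [add_one_le_exp (c * x)]
  have h2 : x * exp (-(c * x)) ≤ 1 / c := by
    rw [le_div_iff₀ hc]
    linarith
  have h3 : exp (-(c * x)) ≤ 1 := exp_le_one_iff.2 (neg_nonpos.2 (by positivity))
  linarith

/-- Away from the resonance `k * s = m * τ` the factor `1 + τ` is absorbed by the oscillation
weight, and near it by the time weight. -/
theorem one_add_mul_exp_resonance_le {α ε k m s τ : ℝ} (hα : 0 < α) (hα1 : α < 1) (hε : 0 < ε)
    (hε1 : ε < 1) (hk : 1 ≤ k) (hm : 1 ≤ m) (hτ : 0 ≤ τ) :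
    (1 + τ) * exp (-ε * s) * exp (-α * |k * s - m * τ|) ≤
      3 / α * exp (-ε * s) + 3 * k / ε * exp (-(α * k) * |s - m * τ / k|) := by
  have hk0 : 0 < k := by linarith
  have hmτ : τ ≤ m * τ := le_mul_of_one_le_left hτ hm
  have habs : k * |s - m * τ / k| = |k * s - m * τ| := by
    rw [← abs_of_pos hk0, ← abs_mul, abs_of_pos hk0]
    congr 1
    field_simp
  rw [show -(α * k) * |s - m * τ / k| = -α * (k * |s - m * τ / k|) by ring, habs]
  rcases le_total (2 * (k * s)) (m * τ) with h | h
  · have h1 : exp (-α * |k * s - m * τ|) ≤ exp (-(α / 2 * τ)) := by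
      refine exp_le_exp.2 ?_
      have : τ / 2 ≤ |k * s - m * τ| := by
        have := neg_le_abs (k * s - m * τ)
        linarith
      nlinarith
    have h2 : (1 + τ) * exp (-(α / 2 * τ)) ≤ 3 / α := by
      refine (one_add_mul_exp_neg_mul_le (by positivity) hτ).trans ?_
      have : 1 ≤ 1 / α := by rw [le_div_iff₀ hα]; linarith
      have e : 1 / (α / 2) = 2 * (1 / α) := by field_simp
      have e' : 3 / α = 3 * (1 / α) := by ring
      rw [e, e']
      linarith
    calc (1 + τ) * exp (-ε * s) * exp (-α * |k * s - m * τ|)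
        ≤ (1 + τ) * exp (-ε * s) * exp (-(α / 2 * τ)) := by gcongr
      _ = (1 + τ) * exp (-(α / 2 * τ)) * exp (-ε * s) := by ring
      _ ≤ 3 / α * exp (-ε * s) := by gcongr
      _ ≤ _ := le_add_of_nonneg_right (by positivity)
  · have h1 : exp (-ε * s) ≤ exp (-(ε / (2 * k) * τ)) := by
      refine exp_le_exp.2 ?_
      have : τ / (2 * k) ≤ s := by
        rw [div_le_iff₀ (by positivity)]
        linarith
      have := mul_le_mul_of_nonneg_left this hε.le
      have e : ε / (2 * k) * τ = ε * (τ / (2 * k)) := by ring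
      rw [e]
      linarith
    have h2 : (1 + τ) * exp (-(ε / (2 * k) * τ)) ≤ 3 * k / ε := by
      refine (one_add_mul_exp_neg_mul_le (by positivity) hτ).trans ?_
      have : 1 ≤ k / ε := by rw [le_div_iff₀ hε]; linarith
      have e : 1 / (ε / (2 * k)) = 2 * (k / ε) := by field_simp
      have e' : 3 * k / ε = 3 * (k / ε) := by ring
      rw [e, e']
      linarith
    calc (1 + τ) * exp (-ε * s) * exp (-α * |k * s - m * τ|)
        ≤ (1 + τ) * exp (-(ε / (2 * k) * τ)) * exp (-α * |k * s - m * τ|) := by gcongr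
      _ ≤ 3 * k / ε * exp (-α * |k * s - m * τ|) := by gcongr
      _ ≤ _ := le_add_of_nonneg_left (by positivity)

open MeasureTheory Set in
theorem lintegral_resonance_le {α ε k m τ : ℝ} (hα : 0 < α) (hε : 0 < ε) (hk : 0 < k) :
    ∫⁻ t in Ioi τ, ENNReal.ofReal (3 / α * exp (-ε * (t - τ)) +
      3 * k / ε * exp (-(α * k) * |t - τ - m * τ / k|)) ≤ ENNReal.ofReal (9 / (α * ε)) := by
  have hsplit : ∀ t : ℝ, ENNReal.ofReal (3 / α * exp (-ε * (t - τ)) +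
      3 * k / ε * exp (-(α * k) * |t - τ - m * τ / k|)) =
      ENNReal.ofReal (3 / α) * ENNReal.ofReal (exp (-ε * (t - τ))) + ENNReal.ofReal (3 * k / ε) *
        ENNReal.ofReal (exp (-(α * k) * |t - (τ + m * τ / k)|)) := by
    intro t
    rw [ENNReal.ofReal_add (by positivity) (by positivity), ENNReal.ofReal_mul (by positivity),
      ENNReal.ofReal_mul (by positivity), sub_sub]
  simp_rw [hsplit]
  rw [lintegral_add_left (by fun_prop), lintegral_const_mul _ (by fun_prop),
    lintegral_const_mul _ (by fun_prop), lintegral_Ioi_ofReal_exp_neg_mul_sub hε]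
  calc _ ≤ ENNReal.ofReal (3 / α) * ENNReal.ofReal (1 / ε) +
        ENNReal.ofReal (3 * k / ε) * ENNReal.ofReal (2 / (α * k)) := by
        gcongr
        exact (setLIntegral_le_lintegral _ _).trans
          (lintegral_ofReal_exp_neg_mul_abs_sub_le (by positivity) _)
    _ = ENNReal.ofReal (9 / (α * ε)) := by
        rw [← ENNReal.ofReal_mul (by positivity), ← ENNReal.ofReal_mul (by positivity),
          ← ENNReal.ofReal_add (by positivity) (by positivity)]
        congr 1
        field_simp
        norm_num

theorem tsum_ofReal_exp_neg_mul_succ_le {α : ℝ} (hα : 0 < α) :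
    ∑' m : ℕ, ENNReal.ofReal (exp (-α * (m + 1))) ≤ ENNReal.ofReal (1 / α) := by
  have hr : exp (-α) < 1 := exp_lt_one_iff.2 (by linarith)
  have hfun : ∀ m : ℕ, exp (-α * (m + 1)) = exp (-α) * exp (-α) ^ m := by
    intro m
    rw [← exp_nat_mul, ← Real.exp_add]
    ring_nf
  have hsum := (hasSum_geometric_of_lt_one (exp_pos (-α)).le hr).mul_left (exp (-α))
  simp_rw [hfun]
  rw [← ENNReal.ofReal_tsum_of_nonneg (fun m => by positivity) hsum.summable, hsum.tsum_eq]
  refine ENNReal.ofReal_le_ofReal ?_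
  rw [← div_eq_mul_inv, div_le_div_iff₀ (by linarith) hα]
  have h1 := add_one_le_exp α
  have h2 : exp (-α) * exp α = 1 := by rw [← Real.exp_add]; simp
  nlinarith [exp_pos (-α)]

/-- Each interaction term is controlled either by the nonresonant bound (modes of equal sign) or by
the resonant bound of the pair `(|k|, |l|)` (modes of opposite sign). -/
theorem echo_term_le {α γ ε t τ : ℝ} {k l : ℤ} (hγ : 0 < γ) (hα : 0 < α) (hα1 : α < 1)
    (hε : 0 < ε) (hε1 : ε < 1) (hτ : 0 ≤ τ) (ht : τ < t) (hk : k ≠ 0) (hl : l ≠ 0) :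
    (1 + τ) * exp (-ε * (t - τ)) * (exp (-α * |(l : ℝ)|) *
      exp (-α * (t - τ) * |((k : ℝ) - (l : ℝ))| / t) *
      exp (-α * |(k : ℝ) * (t - τ) + (l : ℝ) * τ|) / (1 + |((k : ℝ) - (l : ℝ))| ^ γ)) ≤
      2 / α * exp (-ε * (t - τ)) ∨
    (1 + τ) * exp (-ε * (t - τ)) * (exp (-α * |(l : ℝ)|) *
      exp (-α * (t - τ) * |((k : ℝ) - (l : ℝ))| / t) *
      exp (-α * |(k : ℝ) * (t - τ) + (l : ℝ) * τ|) / (1 + |((k : ℝ) - (l : ℝ))| ^ γ)) ≤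
      (|(k : ℝ)| ^ γ)⁻¹ * exp (-α * |(l : ℝ)|) * (3 / α * exp (-ε * (t - τ)) +
        3 * |(k : ℝ)| / ε * exp (-(α * |(k : ℝ)|) * abs (t - τ - |(l : ℝ)| * τ / |(k : ℝ)|))) := by
  have ht0 : 0 < t := hτ.trans_lt ht
  have hs : 0 < t - τ := sub_pos.2 ht
  have hk1 : 1 ≤ |(k : ℝ)| := by exact_mod_cast Int.one_le_abs hk
  have hl1 : 1 ≤ |(l : ℝ)| := by exact_mod_cast Int.one_le_abs hl
  have hmid : exp (-α * (t - τ) * |((k : ℝ) - (l : ℝ))| / t) ≤ 1 := by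
    refine exp_le_one_iff.2 ?_
    rw [neg_mul, neg_mul, neg_div]
    exact neg_nonpos.2 (by positivity)
  have hk0 : (k : ℝ) ≠ 0 := by exact_mod_cast hk
  have hl0 : (l : ℝ) ≠ 0 := by exact_mod_cast hl
  generalize (k : ℝ) = x at *
  generalize (l : ℝ) = y at *
  have hden : 0 ≤ |x - y| ^ γ := by positivity
  rcases lt_or_gt_of_ne (mul_ne_zero hk0 hl0) with hxy | hxy
  · right
    have hsub : |x - y| = |x| + |y| := by
      rcases mul_neg_iff.1 hxy with ⟨h1, h2⟩ | ⟨h1, h2⟩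
      · rw [abs_of_pos h1, abs_of_neg h2, abs_of_pos (by linarith)]; ring
      · rw [abs_of_neg h1, abs_of_pos h2, abs_of_neg (by linarith)]; ring
    have hosc : |x * (t - τ) + y * τ| = abs (|x| * (t - τ) - |y| * τ) := by
      rcases mul_neg_iff.1 hxy with ⟨h1, h2⟩ | ⟨h1, h2⟩
      · rw [abs_of_pos h1, abs_of_neg h2]; congr 1; ring
      · rw [abs_of_neg h1, abs_of_pos h2, ← abs_neg]; congr 1; ring
    have hpow : |x| ^ γ ≤ 1 + |x - y| ^ γ := by
      rw [hsub]
      have : |x| ^ γ ≤ (|x| + |y|) ^ γ := by gcongr; linarith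
      linarith
    have hxpos : 0 < |x| ^ γ := by positivity
    rw [hosc]
    calc _ ≤ (1 + τ) * exp (-ε * (t - τ)) * (exp (-α * |y|) * 1 *
          exp (-α * abs (|x| * (t - τ) - |y| * τ)) / |x| ^ γ) := by gcongr
      _ = (|x| ^ γ)⁻¹ * exp (-α * |y|) * ((1 + τ) * exp (-ε * (t - τ)) *
          exp (-α * abs (|x| * (t - τ) - |y| * τ))) := by ring
      _ ≤ _ := by
          gcongr
          exact one_add_mul_exp_resonance_le hα hα1 hε hε1 hk1 hl1 hτ
  · left
    have hosc : τ ≤ |x * (t - τ) + y * τ| := by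
      rcases mul_pos_iff.1 hxy with ⟨h1, h2⟩ | ⟨h1, h2⟩
      · rw [abs_of_pos h2] at hl1
        refine le_trans ?_ (le_abs_self _)
        nlinarith [mul_pos h1 hs]
      · rw [abs_of_neg h2] at hl1
        refine le_trans ?_ (neg_le_abs _)
        nlinarith [mul_pos (neg_pos.2 h1) hs]
    have hexp : exp (-α * |x * (t - τ) + y * τ|) ≤ exp (-(α * τ)) :=
      exp_le_exp.2 (by nlinarith)
    have hy : exp (-α * |y|) ≤ 1 := exp_le_one_iff.2 (by nlinarith)
    calc _ ≤ (1 + τ) * exp (-ε * (t - τ)) * (1 * 1 * exp (-(α * τ)) / 1) := by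
          gcongr
          linarith
      _ = (1 + τ) * exp (-(α * τ)) * exp (-ε * (t - τ)) := by ring
      _ ≤ _ := by
          gcongr
          refine (one_add_mul_exp_neg_mul_le hα hτ).trans ?_
          have : 1 ≤ 1 / α := by rw [le_div_iff₀ hα]; linarith
          have e : 2 / α = 2 * (1 / α) := by ring
          rw [e]
          linarith

theorem ofReal_exp_mul_echoKernel_le {α γ ε t τ : ℝ} (hγ : 0 < γ) (hα : 0 < α) (hα1 : α < 1)
    (hε : 0 < ε) (hε1 : ε < 1) (hτ : 0 ≤ τ) (ht : τ < t) :
    ENNReal.ofReal (exp (-ε * (t - τ)) * echoKernel α γ t τ) ≤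
      ENNReal.ofReal (2 / α * exp (-ε * (t - τ))) + ∑' (k : ℕ) (m : ℕ),
        ENNReal.ofReal ((((k : ℝ) + 1) ^ γ)⁻¹) * ENNReal.ofReal (exp (-α * ((m : ℝ) + 1))) *
          ENNReal.ofReal (3 / α * exp (-ε * (t - τ)) + 3 * ((k : ℝ) + 1) / ε *
            exp (-(α * ((k : ℝ) + 1)) * |t - τ - ((m : ℝ) + 1) * τ / ((k : ℝ) + 1)|)) := by
  set S := ∑' (k : ℕ) (m : ℕ),
        ENNReal.ofReal ((((k : ℝ) + 1) ^ γ)⁻¹) * ENNReal.ofReal (exp (-α * ((m : ℝ) + 1))) *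
          ENNReal.ofReal (3 / α * exp (-ε * (t - τ)) + 3 * ((k : ℝ) + 1) / ε *
            exp (-(α * ((k : ℝ) + 1)) * |t - τ - ((m : ℝ) + 1) * τ / ((k : ℝ) + 1)|))
  by_cases hT : S = ⊤
  · rw [hT, add_top]
    exact le_top
  have hT' : ENNReal.ofReal (2 / α * exp (-ε * (t - τ))) + S ≠ ⊤ :=
    ENNReal.add_ne_top.2 ⟨ENNReal.ofReal_ne_top, hT⟩
  refine ENNReal.ofReal_le_of_le_toReal ?_
  rw [echoKernel, ← mul_assoc, mul_comm (exp _) (1 + τ), Real.mul_iSup_of_nonneg (by positivity)]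
  refine Real.iSup_le (fun k => ?_) ENNReal.toReal_nonneg
  rw [Real.mul_iSup_of_nonneg (by positivity)]
  refine Real.iSup_le (fun l => ?_) ENNReal.toReal_nonneg
  rw [← ENNReal.ofReal_le_iff_le_toReal hT']
  obtain ⟨k, hk⟩ := k
  obtain ⟨l, hl⟩ := l
  rcases echo_term_le hγ hα hα1 hε hε1 hτ ht hk hl with h | h
  · exact (ENNReal.ofReal_le_ofReal h).trans le_self_add
  · refine (ENNReal.ofReal_le_ofReal h).trans (le_trans ?_ le_add_self)
    have cast_pred : ∀ n : ℤ, n ≠ 0 → (((n.natAbs - 1 : ℕ) : ℝ)) + 1 = |(n : ℝ)| := by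
      intro n hn
      rw [Nat.cast_sub (Int.natAbs_pos.2 hn), Nat.cast_natAbs]
      simp
    have hle := (ENNReal.le_tsum (f := fun m : ℕ => _) (l.natAbs - 1)).trans
      (ENNReal.le_tsum (f := fun k : ℕ => ∑' m : ℕ,
        ENNReal.ofReal ((((k : ℝ) + 1) ^ γ)⁻¹) * ENNReal.ofReal (exp (-α * ((m : ℝ) + 1))) *
          ENNReal.ofReal (3 / α * exp (-ε * (t - τ)) + 3 * ((k : ℝ) + 1) / ε *
            exp (-(α * ((k : ℝ) + 1)) * |t - τ - ((m : ℝ) + 1) * τ / ((k : ℝ) + 1)|)))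
        (k.natAbs - 1))
    simp only [cast_pred k hk, cast_pred l hl] at hle
    rwa [ENNReal.ofReal_mul (by positivity), ENNReal.ofReal_mul (by positivity)]

open MeasureTheory Set in
theorem lintegral_exp_mul_echoKernel_le {α γ ε τ : ℝ} (hγ : 1 < γ) (hα : 0 < α) (hα1 : α < 1)
    (hε : 0 < ε) (hε1 : ε < 1) (hτ : 0 ≤ τ) :
    ∫⁻ t in Ioi τ, ENNReal.ofReal (exp (-ε * (t - τ)) * echoKernel α γ t τ) ≤
      ENNReal.ofReal ((2 + 9 * ∑' k : ℕ, (((k : ℝ) + 1) ^ γ)⁻¹) * (1 / (α ^ 2 * ε))) := by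
  have hZ : Summable fun k : ℕ => (((k : ℝ) + 1) ^ γ)⁻¹ := by
    simpa using (summable_nat_add_iff 1).2 (Real.summable_nat_rpow_inv.2 hγ)
  have hZ0 : 0 ≤ ∑' k : ℕ, (((k : ℝ) + 1) ^ γ)⁻¹ := tsum_nonneg fun k => by positivity
  refine (setLIntegral_mono' measurableSet_Ioi fun t ht =>
    ofReal_exp_mul_echoKernel_le (by linarith) hα hα1 hε hε1 hτ ht).trans ?_
  rw [lintegral_add_left (by fun_prop), lintegral_tsum fun k => by fun_prop]
  have hfirst : ∫⁻ t in Ioi τ, ENNReal.ofReal (2 / α * exp (-ε * (t - τ))) =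
      ENNReal.ofReal (2 / (α * ε)) := by
    simp_rw [ENNReal.ofReal_mul (show 0 ≤ 2 / α by positivity)]
    rw [lintegral_const_mul _ (by fun_prop), lintegral_Ioi_ofReal_exp_neg_mul_sub hε,
      ← ENNReal.ofReal_mul (by positivity)]
    congr 1
    field_simp
  have hsecond : ∀ k : ℕ, ∫⁻ t in Ioi τ, ∑' m : ℕ,
      ENNReal.ofReal ((((k : ℝ) + 1) ^ γ)⁻¹) * ENNReal.ofReal (exp (-α * ((m : ℝ) + 1))) *
        ENNReal.ofReal (3 / α * exp (-ε * (t - τ)) + 3 * ((k : ℝ) + 1) / ε *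
          exp (-(α * ((k : ℝ) + 1)) * |t - τ - ((m : ℝ) + 1) * τ / ((k : ℝ) + 1)|)) ≤
      ENNReal.ofReal ((((k : ℝ) + 1) ^ γ)⁻¹) *
        (ENNReal.ofReal (1 / α) * ENNReal.ofReal (9 / (α * ε))) := by
    intro k
    rw [lintegral_tsum fun m => by fun_prop]
    calc _ ≤ ∑' m : ℕ, ENNReal.ofReal ((((k : ℝ) + 1) ^ γ)⁻¹) *
          ENNReal.ofReal (exp (-α * ((m : ℝ) + 1))) * ENNReal.ofReal (9 / (α * ε)) := by
          refine ENNReal.tsum_le_tsum fun m => ?_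
          rw [lintegral_const_mul _ (by fun_prop)]
          gcongr
          exact lintegral_resonance_le hα hε (by positivity)
      _ ≤ _ := by
          rw [ENNReal.tsum_mul_right, ENNReal.tsum_mul_left, mul_assoc]
          gcongr
          exact tsum_ofReal_exp_neg_mul_succ_le hα
  rw [hfirst]
  calc _ ≤ ENNReal.ofReal (2 / (α * ε)) + ∑' k : ℕ, ENNReal.ofReal ((((k : ℝ) + 1) ^ γ)⁻¹) *
        (ENNReal.ofReal (1 / α) * ENNReal.ofReal (9 / (α * ε))) := by
        gcongr with k
        exact hsecond k
    _ = ENNReal.ofReal (2 / (α * ε) +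
        (∑' k : ℕ, (((k : ℝ) + 1) ^ γ)⁻¹) * (1 / α * (9 / (α * ε)))) := by
        rw [ENNReal.tsum_mul_right, ← ENNReal.ofReal_tsum_of_nonneg (fun k => by positivity) hZ,
          ← ENNReal.ofReal_mul (by positivity), ← ENNReal.ofReal_mul hZ0,
          ← ENNReal.ofReal_add (by positivity) (by positivity)]
    _ ≤ _ := by
        refine ENNReal.ofReal_le_ofReal ?_
        have h1 : 2 / (α * ε) ≤ 2 / (α ^ 2 * ε) := by
          gcongr
          nlinarith
        have h2 : 1 / α * (9 / (α * ε)) = 9 * (1 / (α ^ 2 * ε)) := by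
          field_simp
        rw [h2]
        have h3 : 2 / (α ^ 2 * ε) = 2 * (1 / (α ^ 2 * ε)) := by ring
        linarith

theorem echoKernel_nonneg {α γ t τ : ℝ} (hτ : 0 ≤ τ) : 0 ≤ echoKernel α γ t τ := by
  refine mul_nonneg (by linarith) (Real.iSup_nonneg fun k => Real.iSup_nonneg fun l => ?_)
  positivity

theorem echo_kernel_dual_exponential_moment :
    ∀ γ : ℝ, 1 < γ → ∃ abar > (0:ℝ), ∃ C > (0:ℝ),
      ∀ α : ℝ, 0 < α → α < abar → ∀ ε : ℝ, 0 < ε → ε < 1 → ∀ τ : ℝ, 0 ≤ τ →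
        Real.exp (ε * τ) * ∫ t in Set.Ioi τ, Real.exp (-ε * t) * echoKernel α γ t τ ≤
          C * (1 / (α^2 * ε) + 1 / (α * ε ^ γ)) := by
  intro γ hγ
  have hZ0 : 0 ≤ ∑' k : ℕ, (((k : ℝ) + 1) ^ γ)⁻¹ := tsum_nonneg fun k => by positivity
  refine ⟨1, one_pos, 2 + 9 * ∑' k : ℕ, (((k : ℝ) + 1) ^ γ)⁻¹, by positivity, ?_⟩
  intro α hα hα1 ε hε hε1 τ hτ
  rw [← MeasureTheory.integral_const_mul]
  have hfun : ∀ t : ℝ, exp (ε * τ) * (exp (-ε * t) * echoKernel α γ t τ) =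
      exp (-ε * (t - τ)) * echoKernel α γ t τ := by
    intro t
    rw [← mul_assoc, ← Real.exp_add]
    ring_nf
  simp_rw [hfun]
  have hnorm := MeasureTheory.enorm_integral_le_lintegral_enorm
    (μ := MeasureTheory.volume.restrict (Set.Ioi τ))
    fun t => exp (-ε * (t - τ)) * echoKernel α γ t τ
  have hpos : ∀ t : ℝ, 0 ≤ exp (-ε * (t - τ)) * echoKernel α γ t τ :=
    fun t => mul_nonneg (exp_pos _).le (echoKernel_nonneg hτ)
  simp_rw [Real.enorm_of_nonneg (hpos _)] at hnorm
  rw [Real.enorm_of_nonneg (MeasureTheory.integral_nonneg hpos)] at hnorm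
  have hle := (ENNReal.ofReal_le_ofReal_iff (by positivity)).1
    (hnorm.trans (lintegral_exp_mul_echoKernel_le hγ hα hα1 hε hε1 hτ))
  refine hle.trans ?_
  gcongr
  exact le_add_of_nonneg_right (by positivity)
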